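/- arXiv:math/0407078 — 3 statements merged into one kernel-verified Lean document; each statement's English description precedes it below -/
import Mathlib

section
/- For all real numbers $a, z \in (0,1)$, the Rogers pentagonal (five term) dilogarithm identity holds: $\mathrm{Li}_2(a)+\mathrm{Li}_2(z)=\mathrm{Li}_2(az)+\mathrm{Li}_2\big(\frac{a-az}{1-az}\big)+\mathrm{Li}_2\big(\frac{z-az}{1-az}\big)+\ln\big(\frac{1-z}{1-az}\big)\ln\big(\frac{1-a}{1-az}\big)$. -/
/-- The Euler dilogarithm `Li₂(x) = ∑_{n≥1} xⁿ/n²`. -/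
noncomputable def Li2 (x : ℝ) : ℝ := ∑' n : ℕ, x ^ (n + 1) / ((n : ℝ) + 1) ^ 2

/-- The derivative of the dilogarithm on `(-1, 1)`, as a power series. -/
theorem hasDerivAt_Li2_tsum {x : ℝ} (hx : |x| < 1) :
    HasDerivAt Li2 (∑' n : ℕ, x ^ n / ((n : ℝ) + 1)) x := by
  obtain ⟨r, hxr, hr1⟩ := exists_between hx
  have hr0 : 0 < r := (abs_nonneg x).trans_lt hxr
  have hderiv : ∀ (n : ℕ) (y : ℝ), y ∈ Set.Ioo (-r) r →
      HasDerivAt (fun y : ℝ => y ^ (n + 1) / ((n : ℝ) + 1) ^ 2) (y ^ n / ((n : ℝ) + 1)) y := by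
    intro n y _
    have hn : (n : ℝ) + 1 ≠ 0 := by positivity
    refine ((hasDerivAt_pow (n + 1) y).div_const (((n : ℝ) + 1) ^ 2)).congr_deriv ?_
    simp only [Nat.add_sub_cancel, Nat.cast_add, Nat.cast_one]
    field_simp
  refine hasDerivAt_tsum_of_isPreconnected (u := fun n : ℕ => r ^ n) (t := Set.Ioo (-r) r)
    (y₀ := 0) (summable_geometric_of_lt_one hr0.le hr1) isOpen_Ioo isPreconnected_Ioo
    hderiv ?_ ⟨by linarith, hr0⟩ ?_ (abs_lt.mp hxr)
  · intro n y hy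
    have hn : (1 : ℝ) ≤ (n : ℝ) + 1 := by linarith [n.cast_nonneg (α := ℝ)]
    rw [Real.norm_eq_abs, abs_div, abs_pow, abs_of_pos (by linarith : (0 : ℝ) < n + 1)]
    exact (div_le_self (by positivity) hn).trans
      (pow_le_pow_left₀ (abs_nonneg y) (abs_lt.mpr hy).le n)
  · simp

/-- `Li₂'(x) = -log (1 - x) / x` for `0 < |x| < 1`. -/
theorem hasDerivAt_Li2 {x : ℝ} (hx0 : x ≠ 0) (hx : |x| < 1) :
    HasDerivAt Li2 (-Real.log (1 - x) / x) x := by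
  refine (hasDerivAt_Li2_tsum hx).congr_deriv ?_
  rw [← ((Real.hasSum_pow_div_log_of_abs_lt_one hx).div_const x).tsum_eq]
  refine tsum_congr fun n => ?_
  have hn : (n : ℝ) + 1 ≠ 0 := by positivity
  field_simp
  ring

theorem Li2_zero : Li2 0 = 0 := by
  simp [Li2]

/-- The Rogers pentagonal (five term) dilogarithm identity. -/
theorem rogers_pentagonal_identity (a z : ℝ) (ha : a ∈ Set.Ioo (0 : ℝ) 1)
    (hz : z ∈ Set.Ioo (0 : ℝ) 1) :
    Li2 a + Li2 z =
      Li2 (a * z) + Li2 ((a - a * z) / (1 - a * z)) + Li2 ((z - a * z) / (1 - a * z)) +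
        Real.log ((1 - z) / (1 - a * z)) * Real.log ((1 - a) / (1 - a * z)) := by
  obtain ⟨ha0, ha1⟩ := ha
  obtain ⟨hz0, hz1⟩ := hz
  let F : ℝ → ℝ := fun t => Li2 t - Li2 (t * z) - Li2 ((t - t * z) / (1 - t * z)) -
    Li2 ((z - t * z) / (1 - t * z)) -
    (Real.log (1 - z) - Real.log (1 - t * z)) * (Real.log (1 - t) - Real.log (1 - t * z))
  have hpos : ∀ t : ℝ, t < 1 → 0 < 1 - t * z := fun t ht => by nlinarith
  have hu : ∀ t : ℝ, 0 ≤ t → t < 1 → |(t - t * z) / (1 - t * z)| < 1 := fun t h0 h1 => by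
    rw [abs_of_nonneg (div_nonneg (by nlinarith) (hpos t h1).le), div_lt_one (hpos t h1)]
    linarith
  have hv : ∀ t : ℝ, t < 1 → |(z - t * z) / (1 - t * z)| < 1 := fun t h1 => by
    rw [abs_of_nonneg (div_nonneg (by nlinarith) (hpos t h1).le), div_lt_one (hpos t h1)]
    linarith
  have hw : ∀ t : ℝ, 0 ≤ t → t < 1 → |t * z| < 1 := fun t h0 h1 => by
    rw [abs_of_nonneg (by positivity)]
    linarith [hpos t h1]
  have hcont : ContinuousOn F (Set.Icc 0 a) := by
    rintro t ⟨h0, hta⟩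
    have h1 : t < 1 := hta.trans_lt ha1
    have hne := (hpos t h1).ne'
    have hne' : 1 - t ≠ 0 := by linarith
    have hLi {y : ℝ} (hy : |y| < 1) : ContinuousAt Li2 y := (hasDerivAt_Li2_tsum hy).continuousAt
    have c1 : ContinuousAt (fun s : ℝ => Li2 (s * z)) t :=
      ContinuousAt.comp (f := fun s : ℝ => s * z) (hLi (hw t h0 h1)) (by fun_prop)
    have c2 : ContinuousAt (fun s : ℝ => Li2 ((s - s * z) / (1 - s * z))) t :=
      ContinuousAt.comp (f := fun s : ℝ => (s - s * z) / (1 - s * z)) (hLi (hu t h0 h1))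
        (by fun_prop (disch := exact hne))
    have c3 : ContinuousAt (fun s : ℝ => Li2 ((z - s * z) / (1 - s * z))) t :=
      ContinuousAt.comp (f := fun s : ℝ => (z - s * z) / (1 - s * z)) (hLi (hv t h1))
        (by fun_prop (disch := exact hne))
    have c4 : ContinuousAt (fun s : ℝ => Real.log (1 - s * z)) t :=
      ContinuousAt.log (by fun_prop) hne
    have c5 : ContinuousAt (fun s : ℝ => Real.log (1 - s)) t :=
      ContinuousAt.log (by fun_prop) hne'
    exact (((((hLi (abs_lt.mpr ⟨by linarith, h1⟩)).sub c1).sub c2).sub c3).sub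
      ((continuousAt_const.sub c4).mul (c5.sub c4))).continuousWithinAt
  have hderiv : ∀ t ∈ Set.Ioo 0 a, HasDerivAt F 0 t := by
    rintro t ⟨h0, hta⟩
    have h1 : t < 1 := hta.trans ha1
    have hP := (hpos t h1).ne'
    have ht1 : 1 - t ≠ 0 := by linarith
    have hz1' : 1 - z ≠ 0 := by linarith
    have eu : (t - t * z) / (1 - t * z) ≠ 0 := div_ne_zero (by nlinarith) hP
    have ev : (z - t * z) / (1 - t * z) ≠ 0 := div_ne_zero (by nlinarith) hP
    have lu : Real.log (1 - (t - t * z) / (1 - t * z)) =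
        Real.log (1 - t) - Real.log (1 - t * z) := by
      rw [← Real.log_div ht1 hP]
      congr 1
      rw [one_sub_div hP]
      ring
    have lv : Real.log (1 - (z - t * z) / (1 - t * z)) =
        Real.log (1 - z) - Real.log (1 - t * z) := by
      rw [← Real.log_div hz1' hP]
      congr 1
      rw [one_sub_div hP]
      ring
    have dw : HasDerivAt (fun s : ℝ => s * z) z t := by simpa using (hasDerivAt_id t).mul_const z
    have dP : HasDerivAt (fun s : ℝ => 1 - s * z) (-z) t := dw.const_sub 1
    have d0 := hasDerivAt_Li2 h0.ne' (abs_lt.mpr ⟨by linarith, h1⟩)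
    have d1 := (hasDerivAt_Li2 (mul_pos h0 hz0).ne' (hw t h0.le h1)).comp t dw
    have d2 := (hasDerivAt_Li2 eu (hu t h0.le h1)).comp t (((hasDerivAt_id t).sub dw).div dP hP)
    have d3 := (hasDerivAt_Li2 ev (hv t h1)).comp t ((dw.const_sub z).div dP hP)
    have d4 := dP.log hP
    have d5 := ((hasDerivAt_id t).const_sub 1).log ht1
    refine ((((d0.sub d1).sub d2).sub d3).sub
      ((d4.const_sub (Real.log (1 - z))).mul (d5.sub d4))).congr_deriv ?_
    rw [lu, lv]
    simp only [id, Pi.sub_apply]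
    have e1 : t - t * z = t * (1 - z) := by ring
    have e2 : z - t * z = z * (1 - t) := by ring
    rw [e1, e2]
    generalize Real.log (1 - t) = A
    generalize Real.log (1 - z) = Z
    generalize Real.log (1 - t * z) = P
    field_simp
    ring
  obtain ⟨c, -, hc⟩ := exists_hasDerivAt_eq_slope F (fun _ => 0) ha0 hcont hderiv
  have hF : F a = F 0 := by
    rw [eq_comm, div_eq_zero_iff] at hc
    rcases hc with h | h <;> linarith
  simp only [F, zero_mul, sub_zero, div_one, Li2_zero, Real.log_one, sub_self, mul_zero] at hF
  rw [Real.log_div (by linarith) (hpos a ha1).ne', Real.log_div (by linarith) (hpos a ha1).ne']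
  linarith
end

section
/- For every $q$ with $0<q<1$ and all integers $m,n\ge 0$, the identity $\frac{q^{mn}}{(q;q)_m(q;q)_n}=\sum_{k=0}^{\min(m,n)}\frac{(-1)^k q^{k(k-1)/2}}{(q;q)_{m-k}(q;q)_{n-k}(q;q)_k}$ holds. -/
/-- The q-Pochhammer symbol `(q;q)_k = ∏_{j=1}^{k} (1 - qʲ)`. -/
noncomputable def qPochQ (q : ℝ) (k : ℕ) : ℝ := ∏ j ∈ Finset.range k, (1 - q ^ (j + 1))

theorem qPochQ_succ (q : ℝ) (k : ℕ) : qPochQ q (k + 1) = qPochQ q k * (1 - q ^ (k + 1)) :=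
  Finset.prod_range_succ _ _

theorem one_sub_pow_succ_ne_zero {q : ℝ} (hq : 0 < q) (hq1 : q < 1) (k : ℕ) :
    1 - q ^ (k + 1) ≠ 0 :=
  (sub_pos.2 (pow_lt_one₀ hq.le hq1 k.succ_ne_zero)).ne'

/-- The coefficient `1 / (q;q)_{m-k}`, extended by zero to `k > m`. -/
noncomputable def qPochInv (q : ℝ) (m k : ℕ) : ℝ := if k ≤ m then (qPochQ q (m - k))⁻¹ else 0

theorem qPochInv_succ_succ (q : ℝ) (m k : ℕ) :
    qPochInv q (m + 1) (k + 1) = qPochInv q m k := by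
  simp [qPochInv]

theorem qPochInv_eq_zero (q : ℝ) {m k : ℕ} (h : m < k) : qPochInv q m k = 0 :=
  if_neg h.not_ge

theorem sub_pow_mul_qPochInv {q : ℝ} (hq : 0 < q) (hq1 : q < 1) (m k : ℕ) :
    (q ^ k - q ^ m) * qPochInv q m k = q ^ k * qPochInv q m (k + 1) := by
  rcases lt_trichotomy k m with h | rfl | h
  · obtain ⟨d, rfl⟩ := Nat.exists_eq_add_of_lt h
    have h1 : k + d + 1 - k = d + 1 := by omega
    have h2 : k + d + 1 - (k + 1) = d := by omega
    have h3 := one_sub_pow_succ_ne_zero hq hq1 d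
    rw [qPochInv, if_pos h.le, qPochInv, if_pos (Nat.succ_le_of_lt h), h1, h2, qPochQ_succ, mul_inv,
      show q ^ k - q ^ (k + d + 1) = q ^ k * (1 - q ^ (d + 1)) by ring]
    field_simp
  · simp [qPochInv_eq_zero q k.lt_succ_self]
  · simp [qPochInv_eq_zero q h, qPochInv_eq_zero q (h.trans k.lt_succ_self)]

/-- The `k`-th summand, extended by zero to `k > min m n`. -/
noncomputable def qPentagonalTerm (q : ℝ) (m n k : ℕ) : ℝ :=
  (-1) ^ k * q ^ (k * (k - 1) / 2) * qPochInv q m k * qPochInv q n k * (qPochQ q k)⁻¹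

theorem one_sub_pow_succ_mul_qPentagonalTerm_succ {q : ℝ} (hq : 0 < q) (hq1 : q < 1)
    (m n k : ℕ) :
    (1 - q ^ (k + 1)) * qPentagonalTerm q (m + 1) n (k + 1) =
      -((q ^ k - q ^ n) * qPentagonalTerm q m n k) := by
  have h := sub_pow_mul_qPochInv hq hq1 n k
  have h3 := one_sub_pow_succ_ne_zero hq hq1 k
  have h4 : (k + 1) * (k + 1 - 1) / 2 = k * (k - 1) / 2 + k := by
    rw [Nat.triangle_succ]
  have h5 : (1 - q ^ (k + 1)) * (qPochQ q (k + 1))⁻¹ = (qPochQ q k)⁻¹ := by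
    rw [qPochQ_succ, mul_inv]
    field_simp
  simp only [qPentagonalTerm, qPochInv_succ_succ, h4, pow_add _ _ k, pow_succ (-1 : ℝ) k]
  linear_combination
    (-1) ^ k * q ^ (k * (k - 1) / 2) * qPochInv q m k * (qPochQ q k)⁻¹ * h -
      (-1) ^ k * q ^ (k * (k - 1) / 2) * q ^ k * qPochInv q m k * qPochInv q n (k + 1) * h5

theorem sub_pow_mul_qPentagonalTerm {q : ℝ} (hq : 0 < q) (hq1 : q < 1) (m n k : ℕ) :
    (q ^ k - q ^ (m + 1)) * qPentagonalTerm q (m + 1) n k = q ^ k * qPentagonalTerm q m n k := by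
  have h := sub_pow_mul_qPochInv hq hq1 (m + 1) k
  rw [qPochInv_succ_succ] at h
  simp only [qPentagonalTerm]
  linear_combination (-1) ^ k * q ^ (k * (k - 1) / 2) * qPochInv q n k * (qPochQ q k)⁻¹ * h

theorem one_sub_pow_succ_mul_sum_qPentagonalTerm {q : ℝ} (hq : 0 < q) (hq1 : q < 1) (m n : ℕ) :
    (1 - q ^ (m + 1)) * ∑ k ∈ Finset.range (n + 1), qPentagonalTerm q (m + 1) n k =
      q ^ n * ∑ k ∈ Finset.range (n + 1), qPentagonalTerm q m n k := by
  have h1 : ∑ k ∈ Finset.range (n + 1), (1 - q ^ k) * qPentagonalTerm q (m + 1) n k =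
      ∑ k ∈ Finset.range (n + 1), -((q ^ k - q ^ n) * qPentagonalTerm q m n k) := by
    rw [Finset.sum_range_succ', Finset.sum_range_succ _ n]
    simp only [one_sub_pow_succ_mul_qPentagonalTerm_succ hq hq1]
    simp
  have h2 : ∑ k ∈ Finset.range (n + 1), (q ^ k - q ^ (m + 1)) * qPentagonalTerm q (m + 1) n k =
      ∑ k ∈ Finset.range (n + 1), q ^ k * qPentagonalTerm q m n k :=
    Finset.sum_congr rfl fun k _ => sub_pow_mul_qPentagonalTerm hq hq1 m n k
  have h := congrArg₂ (· + ·) h1 h2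
  simp only [← Finset.sum_add_distrib] at h
  rw [Finset.mul_sum, Finset.mul_sum]
  convert h using 2 <;> ring

theorem sum_qPentagonalTerm {q : ℝ} (hq : 0 < q) (hq1 : q < 1) (m n : ℕ) :
    ∑ k ∈ Finset.range (n + 1), qPentagonalTerm q m n k =
      q ^ (m * n) / (qPochQ q m * qPochQ q n) := by
  induction m with
  | zero =>
    rw [Finset.sum_range_succ', Finset.sum_eq_zero]
    · simp [qPentagonalTerm, qPochInv, qPochQ]
    · intro k _
      simp [qPentagonalTerm, qPochInv]
  | succ m ih =>
    have h3 := one_sub_pow_succ_ne_zero hq hq1 m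
    apply mul_left_cancel₀ h3
    rw [one_sub_pow_succ_mul_sum_qPentagonalTerm hq hq1, ih, qPochQ_succ, Nat.succ_mul, pow_add _ (m * n)]
    generalize 1 - q ^ (m + 1) = c at h3
    field_simp

/-- For `0 < q < 1` and integers `m, n ≥ 0`:
`q^{mn}/((q;q)_m (q;q)_n) = ∑_{k=0}^{min(m,n)} (-1)^k q^{k(k-1)/2} / ((q;q)_{m-k}(q;q)_{n-k}(q;q)_k)`. -/
theorem q_pentagonal_coefficients (q : ℝ) (hq : 0 < q) (hq1 : q < 1) (m n : ℕ) :
    q ^ (m * n) / (qPochQ q m * qPochQ q n) =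
      ∑ k ∈ Finset.range (min m n + 1),
        (-1 : ℝ) ^ k * q ^ (k * (k - 1) / 2) /
          (qPochQ q (m - k) * qPochQ q (n - k) * qPochQ q k) := by
  rw [← sum_qPentagonalTerm hq hq1]
  symm
  refine Finset.sum_subset_zero_on_sdiff (Finset.range_mono (by omega)) ?_ ?_
  · intro k hk
    simp only [Finset.mem_sdiff, Finset.mem_range] at hk
    simp [qPentagonalTerm, qPochInv_eq_zero q (show m < k by omega)]
  · intro k hk
    rw [Finset.mem_range] at hk
    rw [qPentagonalTerm, qPochInv, if_pos (by omega), qPochInv, if_pos (by omega),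
      div_eq_mul_inv, mul_inv, mul_inv]
    ring
end

section
/- For all $q,x\in(0,1)$: $1\le \phi(x)\, e^{\mathrm{Li}_2(x)/\ln q}\le \frac{1}{1-x}$, where $\phi(x)=1/\prod_{n\ge 0}(1-q^n x)$. -/
/-- `φ(x) = 1/∏_{n≥0}(1 - qⁿ x)`. -/
noncomputable def phi (q x : ℝ) : ℝ := 1 / ∏' n : ℕ, (1 - q ^ n * x)

theorem summable_pow_mul_pow_div {q x : ℝ} (hq : q ∈ Set.Ioo (0 : ℝ) 1)
    (hx : x ∈ Set.Ioo (0 : ℝ) 1) :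
    Summable fun p : ℕ × ℕ => (q ^ p.1 * x) ^ (p.2 + 1) / ((p.2 : ℝ) + 1) := by
  obtain ⟨hq0, hq1⟩ := hq
  obtain ⟨hx0, hx1⟩ := hx
  have h := (summable_geometric_of_lt_one hq0.le hq1).mul_of_nonneg
    (summable_geometric_of_lt_one hx0.le hx1) (fun n => by positivity) (fun n => by positivity)
  refine Summable.of_nonneg_of_le (fun p => by positivity) (fun p => ?_) h
  have hqn : q ^ p.1 ≤ 1 := pow_le_one₀ hq0.le hq1.le
  calc (q ^ p.1 * x) ^ (p.2 + 1) / ((p.2 : ℝ) + 1) ≤ (q ^ p.1 * x) ^ (p.2 + 1) :=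
        div_le_self (by positivity) (by linarith [p.2.cast_nonneg (α := ℝ)])
    _ = (q ^ p.1) ^ (p.2 + 1) * x ^ (p.2 + 1) := mul_pow _ _ _
    _ ≤ q ^ p.1 * x ^ p.2 := by
        refine mul_le_mul ?_ ?_ (by positivity) (by positivity)
        · exact pow_le_of_le_one (by positivity) hqn p.2.succ_ne_zero
        · exact pow_le_pow_of_le_one hx0.le hx1.le p.2.le_succ

theorem mul_pow_lt_one {q x : ℝ} (hq : q ∈ Set.Ioo (0 : ℝ) 1) (hx : x ∈ Set.Ioo (0 : ℝ) 1)
    (n : ℕ) : q ^ n * x < 1 :=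
  (mul_le_of_le_one_left hx.1.le (pow_le_one₀ hq.1.le hq.2.le)).trans_lt hx.2

theorem hasSum_neg_log_one_sub_mul_pow {q x : ℝ} (hq : q ∈ Set.Ioo (0 : ℝ) 1)
    (hx : x ∈ Set.Ioo (0 : ℝ) 1) (n : ℕ) :
    HasSum (fun k : ℕ => (q ^ n * x) ^ (k + 1) / ((k : ℝ) + 1)) (-Real.log (1 - q ^ n * x)) := by
  have hpos : 0 < q ^ n * x := mul_pos (pow_pos hq.1 n) hx.1
  apply Real.hasSum_pow_div_log_of_abs_lt_one
  rw [abs_of_pos hpos]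
  exact mul_pow_lt_one hq hx n

/-- The logarithm of `phi q x` is the Lambert-type series `∑_{k≥1} xᵏ / (k (1 - qᵏ))`. -/
theorem exists_hasSum_phi_eq_exp {q x : ℝ} (hq : q ∈ Set.Ioo (0 : ℝ) 1)
    (hx : x ∈ Set.Ioo (0 : ℝ) 1) :
    ∃ S : ℝ, HasSum (fun k : ℕ => x ^ (k + 1) / ((k : ℝ) + 1) * (1 - q ^ (k + 1))⁻¹) S ∧
      phi q x = Real.exp S := by
  have hS := (summable_pow_mul_pow_div hq hx).hasSum
  have hrow := hS.prod_fiberwise (hasSum_neg_log_one_sub_mul_pow hq hx)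
  have hcol (k : ℕ) : HasSum (fun n : ℕ => (q ^ n * x) ^ (k + 1) / ((k : ℝ) + 1))
      (x ^ (k + 1) / ((k : ℝ) + 1) * (1 - q ^ (k + 1))⁻¹) := by
    have h := (hasSum_geometric_of_lt_one (pow_pos hq.1 (k + 1)).le
      (pow_lt_one₀ hq.1.le hq.2 k.succ_ne_zero)).mul_left (x ^ (k + 1) / ((k : ℝ) + 1))
    refine h.congr_fun fun n => ?_
    rw [mul_pow, pow_right_comm]
    ring
  refine ⟨_, ((Equiv.prodComm ℕ ℕ).hasSum_iff.mpr hS).prod_fiberwise hcol, ?_⟩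
  have hlog := hrow.neg
  simp only [neg_neg] at hlog
  rw [phi, ← Real.rexp_tsum_eq_tprod (fun n => sub_pos.mpr (mul_pow_lt_one hq hx n)) hlog.summable,
    hlog.tsum_eq, Real.exp_neg, one_div, inv_inv]

theorem summable_Li2 {x : ℝ} (hx : x ∈ Set.Ioo (0 : ℝ) 1) :
    Summable fun n : ℕ => x ^ (n + 1) / ((n : ℝ) + 1) ^ 2 := by
  obtain ⟨hx0, hx1⟩ := hx
  refine Summable.of_nonneg_of_le (fun n => by positivity) (fun n => ?_)
    (summable_geometric_of_lt_one hx0.le hx1)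
  calc x ^ (n + 1) / ((n : ℝ) + 1) ^ 2 ≤ x ^ (n + 1) :=
        div_le_self (by positivity) (one_le_pow₀ (by linarith [n.cast_nonneg (α := ℝ)]))
    _ ≤ x ^ n := pow_le_pow_of_le_one hx0.le hx1.le (by omega)

theorem inv_le_inv_one_sub_exp_neg {t : ℝ} (ht : 0 < t) : t⁻¹ ≤ (1 - Real.exp (-t))⁻¹ := by
  have h1 : Real.exp (-t) < 1 := Real.exp_lt_one_iff.mpr (by linarith)
  exact inv_anti₀ (by linarith) (by linarith [Real.add_one_le_exp (-t)])

theorem inv_one_sub_exp_neg_le {t : ℝ} (ht : 0 < t) : (1 - Real.exp (-t))⁻¹ ≤ t⁻¹ + 1 := by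
  have h1 : Real.exp (-t) < 1 := Real.exp_lt_one_iff.mpr (by linarith)
  have h2 : Real.exp (-t) ≤ (1 + t)⁻¹ := by
    rw [Real.exp_neg]
    exact inv_anti₀ (by linarith) (by linarith [Real.add_one_le_exp t])
  have h3 : t⁻¹ + 1 = (1 - (1 + t)⁻¹)⁻¹ := by
    have : 1 - (1 + t)⁻¹ = t / (1 + t) := by field_simp; ring
    rw [this]
    field_simp
  rw [h3]
  exact inv_anti₀ (sub_pos.mpr (inv_lt_one_of_one_lt₀ (by linarith))) (by linarith)

/-- For `q, x ∈ (0,1)`: `1 ≤ φ(x) e^{Li₂(x)/ln q} ≤ 1/(1-x)`. -/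
theorem phi_exp_Li2_bounds (q x : ℝ) (hq : q ∈ Set.Ioo (0 : ℝ) 1)
    (hx : x ∈ Set.Ioo (0 : ℝ) 1) :
    1 ≤ phi q x * Real.exp (Li2 x / Real.log q) ∧
      phi q x * Real.exp (Li2 x / Real.log q) ≤ 1 / (1 - x) := by
  obtain ⟨S, hS, hphi⟩ := exists_hasSum_phi_eq_exp hq hx
  have hL : 0 < -Real.log q := neg_pos.mpr (Real.log_neg hq.1 hq.2)
  have hLi : HasSum (fun n : ℕ => x ^ (n + 1) / ((n : ℝ) + 1) * (((n : ℝ) + 1) * -Real.log q)⁻¹)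
      (-(Li2 x / Real.log q)) := by
    have h := (summable_Li2 hx).hasSum.div_const (-Real.log q)
    rw [← div_neg]
    refine h.congr_fun fun n => ?_
    simp only [div_eq_mul_inv, mul_inv, sq]
    ring
  have hlog : HasSum (fun n : ℕ => x ^ (n + 1) / ((n : ℝ) + 1)) (-Real.log (1 - x)) := by
    simpa using hasSum_neg_log_one_sub_mul_pow hq hx 0
  have hpow (n : ℕ) : q ^ (n + 1) = Real.exp (-(((n : ℝ) + 1) * -Real.log q)) := by
    rw [mul_neg, neg_neg, ← Nat.cast_add_one, Real.exp_nat_mul, Real.exp_log hq.1]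
  have hcoeff (n : ℕ) : 0 ≤ x ^ (n + 1) / ((n : ℝ) + 1) :=
    div_nonneg (pow_nonneg hx.1.le _) (by positivity)
  have lower : -(Li2 x / Real.log q) ≤ S := by
    refine hasSum_le (fun n => mul_le_mul_of_nonneg_left ?_ (hcoeff n)) hLi hS
    rw [hpow]
    exact inv_le_inv_one_sub_exp_neg (by positivity)
  have upper : S ≤ -(Li2 x / Real.log q) + -Real.log (1 - x) := by
    refine hasSum_le (fun n => ?_) hS (hLi.add hlog)
    rw [← mul_add_one, hpow]
    exact mul_le_mul_of_nonneg_left (inv_one_sub_exp_neg_le (by positivity)) (hcoeff n)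
  rw [hphi, ← Real.exp_add]
  refine ⟨Real.one_le_exp (by linarith), ?_⟩
  rw [one_div, ← Real.exp_log (sub_pos.mpr hx.2), ← Real.exp_neg]
  exact Real.exp_le_exp.mpr (by linarith)
end
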